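/- Let n ≥ 1, let Ω ⊆ ℝⁿ be open, and let u : Ω → ℝ be a smooth solution of the Lagrangian shrinker potential equation ∑_{i=1}^n arctan λ_i(x) = (1/2) x·∇u(x) − u(x) on Ω, where λ_1(x), …, λ_n(x) are the eigenvalues of D²u(x). Define Θ(x) = (1/2) x·∇u(x) − u(x) and let g(x) = I + (D²u(x))², which is a positive definite (hence invertible) symmetric matrix. Then for all x ∈ Ω, trace( g(x)⁻¹ · D²Θ(x) ) = (1/2) x·∇Θ(x). -/

import Mathlib

/-- The `i`-th partial derivative of `u : ℝⁿ → ℝ` at `x`. -/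
noncomputable def pd {n : ℕ} (u : EuclideanSpace ℝ (Fin n) → ℝ) (i : Fin n)
    (x : EuclideanSpace ℝ (Fin n)) : ℝ :=
  fderiv ℝ u x (EuclideanSpace.single i 1)

/-- The second partial derivative `∂²_{ij} u` at `x`. -/
noncomputable def pd2 {n : ℕ} (u : EuclideanSpace ℝ (Fin n) → ℝ) (i j : Fin n)
    (x : EuclideanSpace ℝ (Fin n)) : ℝ :=
  pd (fun y => pd u j y) i x

/-- The Hessian matrix `D²u(x)`. -/
noncomputable def hessM {n : ℕ} (u : EuclideanSpace ℝ (Fin n) → ℝ)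
    (x : EuclideanSpace ℝ (Fin n)) : Matrix (Fin n) (Fin n) ℝ :=
  Matrix.of fun i j => pd2 u i j x

open Matrix in
/-- **Jacobi's formula** for the derivative of a determinant along a curve of matrices. -/
theorem Matrix.hasDerivAt_det {ι : Type*} [Fintype ι] [DecidableEq ι]
    {A : ℝ → Matrix ι ι ℂ} {A' : Matrix ι ι ℂ} {t : ℝ}
    (h : ∀ i j, HasDerivAt (fun s => A s i j) (A' i j) t) :
    HasDerivAt (fun s => (A s).det) (trace (adjugate (A t) * A')) t := by
  have key : trace (adjugate (A t) * A')
      = ∑ σ : Equiv.Perm ι, ((Equiv.Perm.sign σ : ℤ) : ℂ) *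
        ∑ i, (∏ j ∈ Finset.univ.erase i, A t (σ j) j) • A' (σ i) i := by
    have hcol (i : ι) : (adjugate (A t) * A') i i
        = ((A t).updateCol i (fun k => A' k i)).det := by
      rw [← cramer_apply, cramer_eq_adjugate_mulVec]
      rfl
    simp only [trace, diag_apply, hcol, det_apply', Finset.mul_sum]
    rw [Finset.sum_comm]
    refine Finset.sum_congr rfl fun σ _ => Finset.sum_congr rfl fun i _ => ?_
    rw [← Finset.prod_erase_mul _ _ (Finset.mem_univ i), updateCol_self, smul_eq_mul]
    congr 2
    refine Finset.prod_congr rfl fun j hj => ?_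
    rw [updateCol_ne (Finset.ne_of_mem_erase hj)]
  rw [key]
  simp only [det_apply']
  exact HasDerivAt.fun_sum fun σ _ =>
    (HasDerivAt.fun_finsetProd fun j _ => h (σ j) j).const_mul _

/-- Polar form of `1 + iλ` for real `λ`. -/
theorem Complex.one_add_I_mul_eq (l : ℝ) :
    1 + Complex.I * l = (Real.sqrt (1 + l ^ 2) : ℂ) * Complex.exp (Complex.I * Real.arctan l) := by
  have hs : Real.sqrt (1 + l ^ 2) ≠ 0 := (Real.sqrt_pos.2 (by positivity)).ne'
  rw [mul_comm Complex.I (Real.arctan l : ℂ), Complex.exp_mul_I, ← Complex.ofReal_cos,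
    ← Complex.ofReal_sin, Real.cos_arctan, Real.sin_arctan]
  have hs' : (Real.sqrt (1 + l ^ 2) : ℂ) ≠ 0 := by exact_mod_cast hs
  push_cast
  field_simp

open Matrix in
/-- The argument of `det (1 + iH)` is the Lagrangian angle of the symmetric matrix `H`. -/
theorem Matrix.IsHermitian.det_one_add_I_smul {ι : Type*} [Fintype ι] [DecidableEq ι]
    {H : Matrix ι ι ℝ} (h : H.IsHermitian) :
    ∃ r : ℝ, 0 < r ∧ (1 + Complex.I • H.map Complex.ofRealHom).det
      = r * Complex.exp (Complex.I * (∑ i, Real.arctan (h.eigenvalues i) : ℝ)) := by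
  refine ⟨∏ i, Real.sqrt (1 + h.eigenvalues i ^ 2),
    Finset.prod_pos fun i _ => Real.sqrt_pos.2 (by positivity), ?_⟩
  have hprod : (1 + Complex.I • H.map Complex.ofRealHom).det
      = ∏ i, (1 + Complex.I * (h.eigenvalues i : ℂ)) := by
    have e : (1 + Complex.I • H.map Complex.ofRealHom)
        = (-Complex.I) • (scalar ι Complex.I - H.map Complex.ofRealHom) := by
      rw [smul_sub, scalar_apply, ← smul_one_eq_diagonal, smul_smul]
      simp
    rw [e, det_smul, ← eval_charpoly, charpoly_map, h.charpoly_eq, Polynomial.eval_map,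
      Polynomial.eval₂_finsetProd, ← Finset.card_univ, ← Finset.prod_const,
      ← Finset.prod_mul_distrib]
    refine Finset.prod_congr rfl fun i _ => ?_
    simp [mul_sub]
  rw [hprod, Finset.prod_congr rfl fun i _ => Complex.one_add_I_mul_eq (h.eigenvalues i),
    Finset.prod_mul_distrib, ← Complex.exp_sum]
  push_cast
  rw [Finset.mul_sum]

open Matrix in
/-- `1 + H²` is invertible for a real symmetric matrix `H`. -/
theorem Matrix.IsHermitian.isUnit_det_one_add_sq {ι : Type*} [Fintype ι] [DecidableEq ι]
    {H : Matrix ι ι ℝ} (h : H.IsHermitian) : IsUnit (1 + H ^ 2).det := by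
  have hp : (1 + H * Hᴴ).PosDef :=
    PosDef.one.add_posSemidef (posSemidef_self_mul_conjTranspose H)
  rw [h.eq, ← sq] at hp
  exact hp.det_pos.ne'.isUnit

open Matrix in
/-- The derivative of the Lagrangian angle along a curve `H` of symmetric matrices is
`trace ((1 + H²)⁻¹ H')`. -/
theorem hasDerivAt_lagrangianAngle_eq {ι : Type*} [Fintype ι] [DecidableEq ι]
    {H : ℝ → Matrix ι ι ℝ} {H' : Matrix ι ι ℝ} {φ : ℝ → ℝ} {φ' t : ℝ}
    (hH : ∀ i j, HasDerivAt (fun s => H s i j) (H' i j) t) (hφ : HasDerivAt φ φ' t)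
    (hev : ∀ᶠ s in nhds t, ∃ h : (H s).IsHermitian,
      ∑ i, Real.arctan (h.eigenvalues i) = φ s) :
    φ' = trace ((1 + H t ^ 2)⁻¹ * H') := by
  set A : ℝ → Matrix ι ι ℂ := fun s => 1 + Complex.I • (H s).map Complex.ofRealHom with hA
  set G := (1 + H t ^ 2)⁻¹ with hG
  obtain ⟨ht, htφ⟩ := hev.self_of_nhds
  obtain ⟨r, hr, hdet⟩ := ht.det_one_add_I_smul
  rw [htφ] at hdet
  have hAd : ∀ i j, HasDerivAt (fun s => A s i j)
      ((Complex.I • H'.map Complex.ofRealHom) i j) t := fun i j => by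
    simpa [hA] using ((hH i j).ofReal_comp.const_mul Complex.I).const_add
      ((1 : Matrix ι ι ℂ) i j)
  have hD := (Matrix.hasDerivAt_det hAd).mul
    ((hφ.ofReal_comp.const_mul (-Complex.I)).cexp)
  have him := Complex.imCLM.hasFDerivAt.comp_hasDerivAt t hD
  have hzero : (fun s => Complex.imCLM ((A s).det * Complex.exp (-Complex.I * φ s)))
      =ᶠ[nhds t] fun _ => 0 := by
    filter_upwards [hev] with s ⟨hs, hsφ⟩
    obtain ⟨q, -, hq⟩ := hs.det_one_add_I_smul
    rw [hA, hq, hsφ, mul_assoc, ← Complex.exp_add]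
    simp
  have h0 := him.unique ((hasDerivAt_const t (0 : ℝ)).congr_of_eventuallyEq hzero)
  have hinv : A t * ((1 - Complex.I • (H t).map Complex.ofRealHom) * G.map Complex.ofRealHom)
      = 1 := by
    have hsq : A t * (1 - Complex.I • (H t).map Complex.ofRealHom)
        = (1 + H t ^ 2).map Complex.ofRealHom := by
      rw [Matrix.map_add _ (map_add _), Matrix.map_one _ (map_zero _) (map_one _), sq,
        Matrix.map_mul, hA]
      simp only [add_mul, mul_sub, one_mul, mul_one, smul_mul_smul_comm, Complex.I_mul_I]
      rw [neg_one_smul]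
      abel
    rw [← mul_assoc, hsq, ← Matrix.map_mul, hG,
      Matrix.mul_nonsing_inv _ ht.isUnit_det_one_add_sq,
      Matrix.map_one _ (map_zero _) (map_one _)]
  have hadj : adjugate (A t) = (A t).det •
      ((1 - Complex.I • (H t).map Complex.ofRealHom) * G.map Complex.ofRealHom) := by
    conv_lhs => rw [← mul_one (adjugate (A t)), ← hinv, ← mul_assoc, adjugate_mul, smul_mul, one_mul]
  have htr (M : Matrix ι ι ℝ) : trace (M.map Complex.ofRealHom) = ((trace M : ℝ) : ℂ) := by
    simp [trace]
  have htrace : trace (adjugate (A t) * (Complex.I • H'.map Complex.ofRealHom))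
      = (A t).det * (Complex.I * (trace (G * H') : ℝ) + (trace (H t * G * H') : ℝ)) := by
    rw [hadj, smul_mul, trace_smul, smul_eq_mul, sub_mul, one_mul, sub_mul, trace_sub,
      Matrix.mul_smul, trace_smul, smul_mul, smul_mul, trace_smul, Matrix.mul_smul, trace_smul,
      ← Matrix.map_mul, ← Matrix.map_mul, ← Matrix.map_mul, htr, htr, smul_eq_mul, smul_eq_mul,
      smul_eq_mul, ← mul_assoc Complex.I Complex.I, Complex.I_mul_I]
    ring
  have hexp : Complex.exp (Complex.I * φ t) * Complex.exp (-Complex.I * φ t) = 1 := by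
    rw [← Complex.exp_add]
    simp
  have hval : trace (adjugate (A t) * (Complex.I • H'.map Complex.ofRealHom)) *
        Complex.exp (-Complex.I * φ t) +
      (A t).det * (Complex.exp (-Complex.I * φ t) * (-Complex.I * φ'))
      = (r : ℂ) * (Complex.I * (trace (G * H') - φ' : ℝ) + (trace (H t * G * H') : ℝ)) := by
    rw [htrace, hA, hdet]
    push_cast
    linear_combination ((r : ℂ) * (Complex.I * ((trace (G * H') : ℝ) - φ')
      + (trace (H t * G * H') : ℝ))) * hexp
  rw [hval] at h0
  have h1 : r * (trace (G * H') - φ') = 0 := by simpa using h0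
  have := (mul_eq_zero.1 h1).resolve_left hr.ne'
  linarith

/-- Partial derivatives of a smooth function on an open set are smooth. -/
theorem ContDiffOn.pd {n : ℕ} {Ω : Set (EuclideanSpace ℝ (Fin n))} (hΩ : IsOpen Ω)
    {u : EuclideanSpace ℝ (Fin n) → ℝ} (hu : ContDiffOn ℝ (⊤ : ℕ∞) u Ω) (i : Fin n) :
    ContDiffOn ℝ (⊤ : ℕ∞) (pd u i) Ω :=
  (hu.fderiv_of_isOpen hΩ (m := (⊤ : ℕ∞)) (by simp)).clm_apply contDiffOn_const

theorem ContDiffOn.differentiableAt_of_isOpen {n : ℕ} {Ω : Set (EuclideanSpace ℝ (Fin n))}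
    (hΩ : IsOpen Ω) {u : EuclideanSpace ℝ (Fin n) → ℝ} (hu : ContDiffOn ℝ (⊤ : ℕ∞) u Ω)
    {x : EuclideanSpace ℝ (Fin n)} (hx : x ∈ Ω) : DifferentiableAt ℝ u x :=
  (hu.contDiffAt (hΩ.mem_nhds hx)).differentiableAt (by simp)

/-- Equality of mixed second partial derivatives. -/
theorem pd2_comm {n : ℕ} {Ω : Set (EuclideanSpace ℝ (Fin n))} (hΩ : IsOpen Ω)
    {u : EuclideanSpace ℝ (Fin n) → ℝ} (hu : ContDiffOn ℝ (⊤ : ℕ∞) u Ω)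
    {x : EuclideanSpace ℝ (Fin n)} (hx : x ∈ Ω) (i j : Fin n) :
    pd2 u i j x = pd2 u j i x := by
  have hd : DifferentiableAt ℝ (fderiv ℝ u) x :=
    ((hu.fderiv_of_isOpen hΩ (m := (⊤ : ℕ∞)) (by simp)).contDiffAt
      (hΩ.mem_nhds hx)).differentiableAt (by simp)
  have hpd (i j : Fin n) : pd2 u i j x
      = fderiv ℝ (fderiv ℝ u) x (EuclideanSpace.single i 1) (EuclideanSpace.single j 1) := by
    unfold pd2 pd
    rw [fderiv_clm_apply hd (differentiableAt_const _)]
    simp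
  rw [hpd, hpd]
  exact (hu.contDiffAt (hΩ.mem_nhds hx)).isSymmSndFDerivAt
    (by
      rw [minSmoothness_of_isRCLikeNormedField]
      exact WithTop.coe_le_coe.2 (le_top (a := (2 : ℕ∞)))) _ _

theorem pd_congr {n : ℕ} {Ω : Set (EuclideanSpace ℝ (Fin n))} (hΩ : IsOpen Ω)
    {f g : EuclideanSpace ℝ (Fin n) → ℝ} (hfg : Set.EqOn f g Ω)
    {x : EuclideanSpace ℝ (Fin n)} (hx : x ∈ Ω) (i : Fin n) : pd f i x = pd g i x := by
  unfold pd
  rw [(hfg.eventuallyEq_of_mem (hΩ.mem_nhds hx)).fderiv_eq]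

/-- Partial derivatives of `½ ∑ xᵢ fᵢ - g`. -/
theorem pd_half_sum_coord_mul_sub {n : ℕ} {f : Fin n → EuclideanSpace ℝ (Fin n) → ℝ}
    {g : EuclideanSpace ℝ (Fin n) → ℝ} {x : EuclideanSpace ℝ (Fin n)}
    (hf : ∀ i, DifferentiableAt ℝ (f i) x) (hg : DifferentiableAt ℝ g x) (j : Fin n) :
    pd (fun y => (1 / 2) * (∑ i, y i * f i y) - g y) j x
      = (1 / 2) * (∑ i, x i * pd (f i) j x) + (1 / 2) * f j x - pd g j x := by
  have h := ((HasFDerivAt.fun_sum (u := Finset.univ) fun i _ =>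
    (EuclideanSpace.proj (𝕜 := ℝ) i).hasFDerivAt.mul (hf i).hasFDerivAt).const_mul
      (1 / 2 : ℝ)).sub hg.hasFDerivAt
  have h' : HasFDerivAt (fun y : EuclideanSpace ℝ (Fin n) =>
    (1 / 2) * (∑ i, y i * f i y) - g y) _ x := h
  unfold pd
  rw [h'.fderiv]
  simp [Finset.sum_add_distrib]

theorem hasDerivAt_pd {n : ℕ} {f : EuclideanSpace ℝ (Fin n) → ℝ}
    {x : EuclideanSpace ℝ (Fin n)} (hf : DifferentiableAt ℝ f x) (k : Fin n) :
    HasDerivAt (fun s : ℝ => f (x + s • EuclideanSpace.single k 1)) (pd f k x) 0 :=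
  hf.hasFDerivAt.hasLineDerivAt _

/-- On a graphical Lagrangian shrinker, the Lagrangian angle
`Θ = (1/2) x·∇u − u` satisfies the non-divergence equation
`g^{ij} D_{ij}Θ = (1/2) x·DΘ`, where `g = I + (D²u)²` is the induced metric. -/
theorem lagrangian_angle_equation
    (n : ℕ) (hn : 1 ≤ n) (Ω : Set (EuclideanSpace ℝ (Fin n))) (hΩ : IsOpen Ω)
    (u : EuclideanSpace ℝ (Fin n) → ℝ) (hu : ContDiffOn ℝ (⊤ : ℕ∞) u Ω)
    (heq : ∀ x ∈ Ω, ∀ h : (hessM u x).IsHermitian,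
      ∑ i, Real.arctan (h.eigenvalues i)
        = (1 / 2) * (∑ i, x i * pd u i x) - u x)
    (Θ : EuclideanSpace ℝ (Fin n) → ℝ)
    (hΘ : ∀ y, Θ y = (1 / 2) * (∑ i, y i * pd u i y) - u y) :
    ∀ x ∈ Ω,
      Matrix.trace ((1 + hessM u x ^ 2)⁻¹ * hessM Θ x)
        = (1 / 2) * ∑ i, x i * pd Θ i x := by
  intro x hx
  obtain rfl : Θ = fun y => (1 / 2) * (∑ i, y i * pd u i y) - u y := funext hΘ
  set Θ : EuclideanSpace ℝ (Fin n) → ℝ := fun y => (1 / 2) * (∑ i, y i * pd u i y) - u y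
  have hd1 (i : Fin n) := hu.pd hΩ i
  have hd2 (i j : Fin n) : ContDiffOn ℝ (⊤ : ℕ∞) (pd2 u i j) Ω := (hd1 j).pd hΩ i
  have hdiff1 (i : Fin n) {y} (hy : y ∈ Ω) := (hd1 i).differentiableAt_of_isOpen hΩ hy
  have hdiff2 (i j : Fin n) {y} (hy : y ∈ Ω) := (hd2 i j).differentiableAt_of_isOpen hΩ hy
  have hherm {y} (hy : y ∈ Ω) : (hessM u y).IsHermitian := by
    ext i j
    simp [hessM, pd2_comm hΩ hu hy i j]
  have hpdΘ (j : Fin n) : Set.EqOn (pd Θ j)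
      (fun y => (1 / 2) * (∑ i, y i * pd2 u j i y) - (1 / 2) * pd u j y) Ω := fun y hy => by
    have h := pd_half_sum_coord_mul_sub (fun i => hdiff1 i hy)
      (hu.differentiableAt_of_isOpen hΩ hy) j
    simp only [Θ, h, pd2]
    ring
  have hpd2Θ (i j : Fin n) : pd2 Θ i j x
      = (1 / 2) * ∑ k, x k * pd (pd2 u i j) k x := by
    have h := pd_half_sum_coord_mul_sub (fun k => hdiff2 j k hx)
      ((hdiff1 j hx).const_mul (1 / 2)) i
    have hc : pd (fun y => 1 / 2 * pd u j y) i x = 1 / 2 * pd2 u i j x :=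
      DFunLike.congr_fun (fderiv_const_mul (hdiff1 j hx) (1 / 2)) _
    have h3 (k : Fin n) : pd (pd2 u j k) i x = pd (pd2 u i j) k x := by
      rw [pd_congr hΩ (fun y hy => pd2_comm hΩ hu hy j k) hx i]
      exact pd2_comm hΩ (hd1 j) hx i k
    have hΘ2 : pd2 Θ i j x = _ := pd_congr hΩ (hpdΘ j) hx i
    rw [hΘ2, h, hc, pd2_comm hΩ hu hx j i]
    simp only [h3]
    ring
  have hΘd : DifferentiableAt ℝ Θ x := by
    have h (i : Fin n) : DifferentiableAt ℝ (fun y : EuclideanSpace ℝ (Fin n) => y i) x :=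
      (EuclideanSpace.proj (𝕜 := ℝ) i).differentiableAt
    exact ((DifferentiableAt.fun_sum fun i _ => (h i).mul (hdiff1 i hx)).const_mul _).sub
      (hu.differentiableAt_of_isOpen hΩ hx)
  have hangle (k : Fin n) : pd Θ k x = Matrix.trace ((1 + hessM u x ^ 2)⁻¹ *
      Matrix.of fun i j => pd (pd2 u i j) k x) := by
    have hline : ContinuousAt
        (fun s : ℝ => x + s • (EuclideanSpace.single k 1 : EuclideanSpace ℝ (Fin n))) 0 := by
      fun_prop
    have h := hasDerivAt_lagrangianAngle_eq
      (H := fun s : ℝ => hessM u (x + s • EuclideanSpace.single k 1))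
      (H' := Matrix.of fun i j => pd (pd2 u i j) k x) (t := 0)
      (fun i j => hasDerivAt_pd (hdiff2 i j hx) k) (hasDerivAt_pd hΘd k)
      (by
        filter_upwards [hline.eventually_mem (hΩ.mem_nhds (by simpa using hx))] with s hs
        exact ⟨hherm hs, heq _ hs (hherm hs)⟩)
    simpa using h
  have hhess : hessM Θ x
      = (1 / 2 : ℝ) • ∑ k, x k • Matrix.of fun i j => pd (pd2 u i j) k x := by
    ext i j
    simp [hessM, hpd2Θ, Matrix.sum_apply]
  rw [hhess, Matrix.mul_smul, Matrix.trace_smul, Matrix.mul_sum, Matrix.trace_sum, smul_eq_mul]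
  simp only [Matrix.mul_smul, Matrix.trace_smul, smul_eq_mul, hangle]
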